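/- Let α > 1 and δ ∈ (0,1). Then the function p ↦ p^α·(p−δ)^{1−α} is convex on (δ,1), and its infimum over p ∈ (δ,1) equals δ·α^α·(α−1)^{1−α} if α·δ < 1, and equals (1−δ)^{1−α} if α·δ ≥ 1. -/

import Mathlib

open Real

/-- The tangent plane at slope `t` supports the perspective `p ^ α * q ^ (1 - α)` of `x ↦ x ^ α`. -/
theorem tangent_le_rpow_mul_rpow {α t p q : ℝ} (hα : 1 ≤ α) (ht : 0 < t) (hp : 0 < p)
    (hq : 0 < q) :
    α * t ^ (α - 1) * p + (1 - α) * t ^ α * q ≤ p ^ α * q ^ (1 - α) := by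
  have hpos : 0 < p / (t * q) := by positivity
  have bernoulli := one_add_mul_self_le_rpow_one_add (s := p / (t * q) - 1) (by linarith) hα
  rw [add_sub_cancel, div_rpow hp.le (by positivity), mul_rpow ht.le hq.le] at bernoulli
  have htα : 0 < t ^ α := rpow_pos_of_pos ht α
  have hqα : 0 < q ^ α := rpow_pos_of_pos hq α
  have scaled := mul_le_mul_of_nonneg_right bernoulli (mul_pos htα hq).le
  rw [rpow_sub_one ht.ne', rpow_sub hq, rpow_one]
  refine le_trans (le_of_eq ?_) (scaled.trans_eq ?_)
  · field_simp
    ring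
  · field_simp

/-- Each tangent plane touches `p ^ α * q ^ (1 - α)` along the ray `p / q = t`. -/
theorem tangent_eq_rpow_mul_rpow {α p q : ℝ} (hp : 0 < p) (hq : 0 < q) :
    α * (p / q) ^ (α - 1) * p + (1 - α) * (p / q) ^ α * q = p ^ α * q ^ (1 - α) := by
  rw [rpow_sub_one (div_pos hp hq).ne', rpow_sub hq, rpow_one, div_rpow hp.le hq.le]
  have hqα : 0 < q ^ α := rpow_pos_of_pos hq α
  field_simp
  ring

theorem convexOn_rpow_mul_sub_rpow {α δ : ℝ} (hα : 1 ≤ α) (hδ : 0 ≤ δ) :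
    ConvexOn ℝ (Set.Ioo δ 1) (fun p : ℝ => p ^ α * (p - δ) ^ (1 - α)) := by
  refine ⟨convex_Ioo δ 1, fun x hx y hy a b ha hb hab => ?_⟩
  have hz := convex_Ioo δ 1 hx hy ha hb hab
  simp only [smul_eq_mul] at hz ⊢
  have hzp : 0 < a * x + b * y := hδ.trans_lt hz.1
  have hzq : 0 < a * x + b * y - δ := sub_pos.2 hz.1
  have ht := div_pos hzp hzq
  rw [← tangent_eq_rpow_mul_rpow hzp hzq]
  generalize (a * x + b * y) / (a * x + b * y - δ) = t at ht
  have tangent_x := mul_le_mul_of_nonneg_left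
    (tangent_le_rpow_mul_rpow hα ht (hδ.trans_lt hx.1) (sub_pos.2 hx.1)) ha
  have tangent_y := mul_le_mul_of_nonneg_left
    (tangent_le_rpow_mul_rpow hα ht (hδ.trans_lt hy.1) (sub_pos.2 hy.1)) hb
  refine le_trans (le_of_eq ?_) (add_le_add tangent_x tangent_y)
  linear_combination (1 - α) * t ^ α * δ * hab

/-- The minimum over the whole ray `p > δ`, attained at `p = α * δ`. -/
theorem le_rpow_mul_sub_rpow {α δ p : ℝ} (hα : 1 < α) (hδ : 0 ≤ δ) (hp : δ < p) :
    δ * α ^ α * (α - 1) ^ (1 - α) ≤ p ^ α * (p - δ) ^ (1 - α) := by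
  have hα0 : 0 < α := by linarith
  have hα1 : 0 < α - 1 := by linarith
  refine le_trans (le_of_eq ?_) (tangent_le_rpow_mul_rpow hα.le (div_pos hα0 hα1)
    (hδ.trans_lt hp) (sub_pos.2 hp))
  have hpow : 0 < (α - 1) ^ α := rpow_pos_of_pos hα1 α
  rw [rpow_sub_one (div_pos hα0 hα1).ne', rpow_sub hα1, rpow_one, div_rpow hα0.le hα1.le]
  field_simp
  ring

theorem rpow_mul_sub_rpow_mul_self {α δ : ℝ} (hα : 1 < α) (hδ : 0 < δ) :
    (α * δ) ^ α * (α * δ - δ) ^ (1 - α) = δ * α ^ α * (α - 1) ^ (1 - α) := by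
  have hα0 : 0 < α := by linarith
  have hα1 : 0 < α - 1 := by linarith
  have hpow : 0 < δ ^ α := rpow_pos_of_pos hδ α
  rw [show α * δ - δ = (α - 1) * δ by ring, mul_rpow hα0.le hδ.le, mul_rpow hα1.le hδ.le,
    rpow_sub hδ, rpow_one]
  field_simp

/-- If the critical point `α * δ` is at least `1`, the value at `1` is a lower bound on `(δ, 1]`. -/
theorem one_sub_rpow_le_rpow_mul_sub_rpow {α δ p : ℝ} (hα : 1 ≤ α) (hδ : 0 ≤ δ)
    (hαδ : 1 ≤ α * δ) (hp : δ < p) (hp1 : p ≤ 1) :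
    (1 - δ) ^ (1 - α) ≤ p ^ α * (p - δ) ^ (1 - α) := by
  have hq : 0 < 1 - δ := by linarith
  have ht : 0 < 1 / (1 - δ) := by positivity
  have htα : 0 < (1 / (1 - δ)) ^ α := rpow_pos_of_pos ht α
  refine le_trans ?_ (tangent_le_rpow_mul_rpow hα ht (hδ.trans_lt hp) (sub_pos.2 hp))
  have touch := tangent_eq_rpow_mul_rpow (α := α) one_pos hq
  rw [one_rpow, one_mul] at touch
  rw [← touch, rpow_sub_one ht.ne', div_div_eq_mul_div, div_one]
  nlinarith [mul_nonneg htα.le (mul_nonneg (sub_nonneg.2 hαδ) (sub_nonneg.2 hp1))]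

theorem stmt14 (α δ : ℝ) (hα : 1 < α) (hδ : δ ∈ Set.Ioo (0 : ℝ) 1) :
    ConvexOn ℝ (Set.Ioo δ 1) (fun p : ℝ => p ^ α * (p - δ) ^ (1 - α)) ∧
    (α * δ < 1 →
      (⨅ p : Set.Ioo δ 1, (p : ℝ) ^ α * ((p : ℝ) - δ) ^ (1 - α))
        = δ * α ^ α * (α - 1) ^ (1 - α)) ∧
    (α * δ ≥ 1 →
      (⨅ p : Set.Ioo δ 1, (p : ℝ) ^ α * ((p : ℝ) - δ) ^ (1 - α))
        = (1 - δ) ^ (1 - α)) := by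
  obtain ⟨hδ0, hδ1⟩ := hδ
  have : Nonempty (Set.Ioo δ 1) := (Set.nonempty_Ioo.2 hδ1).to_subtype
  have bdd : BddBelow (Set.range fun p : Set.Ioo δ 1 =>
      (p : ℝ) ^ α * ((p : ℝ) - δ) ^ (1 - α)) := by
    refine ⟨δ * α ^ α * (α - 1) ^ (1 - α), ?_⟩
    rintro _ ⟨p, rfl⟩
    exact le_rpow_mul_sub_rpow hα hδ0.le p.2.1
  refine ⟨convexOn_rpow_mul_sub_rpow hα.le hδ0.le, fun h => le_antisymm ?_ ?_,
    fun h => le_antisymm ?_ ?_⟩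
  · rw [← rpow_mul_sub_rpow_mul_self hα hδ0]
    exact ciInf_le bdd ⟨α * δ, by nlinarith, h⟩
  · exact le_ciInf fun p => le_rpow_mul_sub_rpow hα hδ0.le p.2.1
  · have hcont : ContinuousAt (fun p : ℝ => p ^ α * (p - δ) ^ (1 - α)) 1 :=
      (continuousAt_id.rpow_const (Or.inl one_ne_zero)).mul
        ((continuousAt_id.sub continuousAt_const).rpow_const (Or.inl (sub_pos.2 hδ1).ne'))
    have hlim := hcont.tendsto.mono_left (nhdsWithin_le_nhds (s := Set.Iio 1))
    rw [one_rpow, one_mul] at hlim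
    refine ge_of_tendsto hlim ?_
    filter_upwards [Ioo_mem_nhdsLT hδ1] with p hp
    exact ciInf_le bdd ⟨p, hp⟩
  · exact le_ciInf fun p => one_sub_rpow_le_rpow_mul_sub_rpow hα.le hδ0.le h p.2.1 p.2.2.le
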